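/- Let (M,g_E) be a closed positive Einstein manifold with Einstein constant μ and v smooth with Δv = 2μv. The second variation of the Ricci tensor along g_t = (1+tv) g_E is d²/dt²|_{t=0} Ric_{g_t} = −(n/2 − 2)|∇v|² g_E − 2μ v² g_E + 3(n/2 − 1) ∇v⊗∇v + (n−2) v ∇²v. -/

import Mathlib

open scoped BigOperators

noncomputable section

/-- A coordinate chart for an `n`-dimensional Riemannian manifold. -/
abbrev Chart (n : ℕ) := EuclideanSpace ℝ (Fin n)

/-- A Riemannian metric in the chart, given by its matrix of coefficient functions `g_{ij}`. -/
abbrev Met (n : ℕ) := Chart n → Matrix (Fin n) (Fin n) ℝ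

/-- A symmetric `(0,2)`-tensor field in the chart. -/
abbrev Ten (n : ℕ) := Chart n → Matrix (Fin n) (Fin n) ℝ

/-- Partial derivative `∂_i f` in the `i`-th coordinate direction. -/
def pd {n : ℕ} (i : Fin n) (f : Chart n → ℝ) (x : Chart n) : ℝ :=
  fderiv ℝ f x (EuclideanSpace.single i 1)

/-- The inverse metric `g^{ij}`. -/
def ginv {n : ℕ} (G : Met n) (x : Chart n) : Matrix (Fin n) (Fin n) ℝ := (G x)⁻¹

/-- Christoffel symbols `Γ^k_{ij}` of the Levi-Civita connection of `G`. -/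
def chr {n : ℕ} (G : Met n) (k i j : Fin n) (x : Chart n) : ℝ :=
  (1/2) * ∑ l, ginv G x k l *
    (pd i (fun y => G y j l) x + pd j (fun y => G y i l) x - pd l (fun y => G y i j) x)

/-- The Hessian `(∇² f)_{ij} = ∂_i ∂_j f − Γ^k_{ij} ∂_k f`. -/
def hessC {n : ℕ} (G : Met n) (f : Chart n → ℝ) (i j : Fin n) (x : Chart n) : ℝ :=
  pd i (pd j f) x - ∑ k, chr G k i j x * pd k f x

/-- The nonnegative Laplace–Beltrami operator `Δ f = −tr_g ∇² f = −g^{ij} (∇²f)_{ij}`. -/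
def lapC {n : ℕ} (G : Met n) (f : Chart n → ℝ) (x : Chart n) : ℝ :=
  - ∑ i, ∑ j, ginv G x i j * hessC G f i j x

/-- The gradient `(grad f)^k = g^{kj} ∂_j f`. -/
def gradv {n : ℕ} (G : Met n) (f : Chart n → ℝ) (k : Fin n) (x : Chart n) : ℝ :=
  ∑ j, ginv G x k j * pd j f x

/-- The squared gradient norm `|∇f|² = g^{ij} ∂_i f ∂_j f`. -/
def gradsq {n : ℕ} (G : Met n) (f : Chart n → ℝ) (x : Chart n) : ℝ :=
  ∑ i, ∑ j, ginv G x i j * pd i f x * pd j f x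

/-- The covariant derivative `(∇_i h)_{jk}` of a `(0,2)`-tensor. -/
def covD {n : ℕ} (G : Met n) (h : Ten n) (i j k : Fin n) (x : Chart n) : ℝ :=
  pd i (fun y => h y j k) x - (∑ m, chr G m i j x * h x m k) - ∑ m, chr G m i k x * h x j m

/-- The divergence `(δh)_j = −g^{ik} (∇_i h)_{kj}` of a `(0,2)`-tensor. -/
def divT {n : ℕ} (G : Met n) (h : Ten n) (j : Fin n) (x : Chart n) : ℝ :=
  - ∑ i, ∑ k, ginv G x i k * covD G h i k j x

/-- The trace `tr_g h = g^{ij} h_{ij}`. -/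
def trT {n : ℕ} (G : Met n) (h : Ten n) (x : Chart n) : ℝ :=
  ∑ i, ∑ j, ginv G x i j * h x i j

/-- The Ricci tensor in coordinates. -/
def ricci {n : ℕ} (G : Met n) (i j : Fin n) (x : Chart n) : ℝ :=
  (∑ k, pd k (fun y => chr G k i j y) x) - (∑ k, pd j (fun y => chr G k k i y) x)
    + (∑ k, ∑ l, chr G k k l x * chr G l i j x) - ∑ k, ∑ l, chr G k j l x * chr G l k i x

/-- The scalar curvature `scal = g^{ij} Ric_{ij}`. -/
def scalC {n : ℕ} (G : Met n) (x : Chart n) : ℝ :=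
  ∑ i, ∑ j, ginv G x i j * ricci G i j x

/-- The components `R^m_{kil}` of the curvature tensor, `R(∂_k,∂_i)∂_l = R^m_{kil} ∂_m`. -/
def riemUp {n : ℕ} (G : Met n) (m k i l : Fin n) (x : Chart n) : ℝ :=
  pd k (fun y => chr G m i l y) x - pd i (fun y => chr G m k l y) x
    + (∑ p, chr G m k p x * chr G p i l x) - ∑ p, chr G m i p x * chr G p k l x

/-- The `(0,4)` curvature tensor `R_{kilj} = g(R(∂_k,∂_i)∂_l, ∂_j)`. -/
def riem4 {n : ℕ} (G : Met n) (k i l j : Fin n) (x : Chart n) : ℝ :=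
  ∑ m, G x j m * riemUp G m k i l x

/-- The curvature action `(R̊h)_{ij} = R_{kilj} h^{kl}` on symmetric `(0,2)`-tensors. -/
def ringR {n : ℕ} (G : Met n) (h : Ten n) (i j : Fin n) (x : Chart n) : ℝ :=
  ∑ k, ∑ l, ∑ p, ∑ q, ginv G x k p * ginv G x l q * riem4 G k i l j x * h x p q

/-- The second covariant derivative `(∇²_{k,l} h)_{ij}` of a `(0,2)`-tensor. -/
def covD2 {n : ℕ} (G : Met n) (h : Ten n) (k l i j : Fin n) (x : Chart n) : ℝ :=
  pd k (fun y => covD G h l i j y) x - (∑ m, chr G m k l x * covD G h m i j x)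
    - (∑ m, chr G m k i x * covD G h l m j x) - ∑ m, chr G m k j x * covD G h l i m x

/-- The rough (connection) Laplacian `(∇*∇ h)_{ij} = −g^{kl} (∇²_{k,l} h)_{ij}`. -/
def roughLap {n : ℕ} (G : Met n) (h : Ten n) (i j : Fin n) (x : Chart n) : ℝ :=
  - ∑ k, ∑ l, ginv G x k l * covD2 G h k l i j x

/-- The Einstein operator `Δ_E = ∇*∇ − 2R̊`. -/
def einOp {n : ℕ} (G : Met n) (h : Ten n) (i j : Fin n) (x : Chart n) : ℝ :=
  roughLap G h i j x - 2 * ringR G h i j x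

section Coordinates

variable {n : ℕ}

lemma pd_add (i : Fin n) {f g : Chart n → ℝ} {x : Chart n} (hf : DifferentiableAt ℝ f x)
    (hg : DifferentiableAt ℝ g x) : pd i (fun y => f y + g y) x = pd i f x + pd i g x := by
  simp [pd, fderiv_fun_add hf hg]

lemma pd_sub (i : Fin n) {f g : Chart n → ℝ} {x : Chart n} (hf : DifferentiableAt ℝ f x)
    (hg : DifferentiableAt ℝ g x) : pd i (fun y => f y - g y) x = pd i f x - pd i g x := by
  simp [pd, fderiv_fun_sub hf hg]

lemma pd_mul (i : Fin n) {f g : Chart n → ℝ} {x : Chart n} (hf : DifferentiableAt ℝ f x)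
    (hg : DifferentiableAt ℝ g x) :
    pd i (fun y => f y * g y) x = f x * pd i g x + pd i f x * g x := by
  simp [pd, fderiv_fun_mul hf hg, mul_comm]

lemma pd_sum {ι : Type*} (s : Finset ι) (i : Fin n) {f : ι → Chart n → ℝ} {x : Chart n}
    (hf : ∀ k, DifferentiableAt ℝ (f k) x) :
    pd i (fun y => ∑ k ∈ s, f k y) x = ∑ k ∈ s, pd i (f k) x := by
  simp [pd, fderiv_fun_sum fun k _ => hf k]

lemma pd_congr (i : Fin n) {f g : Chart n → ℝ} {x : Chart n} (h : f =ᶠ[nhds x] g) :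
    pd i f x = pd i g x := by
  simp [pd, h.fderiv_eq]

lemma contDiff_pd (i : Fin n) {f : Chart n → ℝ} (hf : ContDiff ℝ (⊤ : ℕ∞) f) :
    ContDiff ℝ (⊤ : ℕ∞) (pd i f) :=
  (hf.fderiv_right (m := (⊤ : ℕ∞)) le_rfl).clm_apply contDiff_const

lemma ContDiff.differentiableAt_of_smooth {f : Chart n → ℝ} (hf : ContDiff ℝ (⊤ : ℕ∞) f)
    (x : Chart n) : DifferentiableAt ℝ f x :=
  hf.differentiable (by simp) x

lemma pd_comm (i j : Fin n) {f : Chart n → ℝ} (hf : ContDiff ℝ (⊤ : ℕ∞) f) (x : Chart n) :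
    pd i (pd j f) x = pd j (pd i f) x := by
  have hd : DifferentiableAt ℝ (fderiv ℝ f) x :=
    (hf.fderiv_right (m := (⊤ : ℕ∞)) le_rfl).differentiable (by simp) x
  have key : ∀ k l : Fin n, pd k (pd l f) x
      = fderiv ℝ (fderiv ℝ f) x (EuclideanSpace.single k 1) (EuclideanSpace.single l 1) := by
    intro k l
    change fderiv ℝ (fun y => fderiv ℝ f y (EuclideanSpace.single l 1)) x _ = _
    rw [fderiv_clm_apply hd (differentiableAt_const _)]
    simp
  have hs : IsSymmSndFDerivAt ℝ f x :=
    hf.contDiffAt.isSymmSndFDerivAt (by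
      rw [minSmoothness_of_isRCLikeNormedField]
      exact WithTop.coe_le_coe.2 (le_top : (2 : ℕ∞) ≤ ⊤))
  rw [key, key, hs.eq]

lemma contDiff_det {m : ℕ} {M : Chart n → Matrix (Fin m) (Fin m) ℝ}
    (hM : ∀ i j, ContDiff ℝ (⊤ : ℕ∞) fun x => M x i j) :
    ContDiff ℝ (⊤ : ℕ∞) fun x => (M x).det := by
  simp only [Matrix.det_apply']
  exact ContDiff.sum fun σ _ => contDiff_const.mul (contDiff_prod fun i _ => hM _ _)

lemma contDiff_ginv {G : Met n} (hG : ∀ i j : Fin n, ContDiff ℝ (⊤ : ℕ∞) fun x => G x i j)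
    (hdet : ∀ x, (G x).det ≠ 0) (i j : Fin n) : ContDiff ℝ (⊤ : ℕ∞) fun x => ginv G x i j := by
  simp only [ginv, Matrix.inv_def, Ring.inverse_eq_inv', Matrix.smul_apply, smul_eq_mul,
    Matrix.adjugate_apply]
  refine ((contDiff_det hG).inv hdet).mul (contDiff_det fun k l => ?_)
  by_cases h : k = j
  · simp only [h, Matrix.updateRow_self]
    exact contDiff_const
  · simp only [Matrix.updateRow_ne h]
    exact hG k l

lemma contDiff_chr {G : Met n} (hG : ∀ i j : Fin n, ContDiff ℝ (⊤ : ℕ∞) fun x => G x i j)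
    (hdet : ∀ x, (G x).det ≠ 0) (k i j : Fin n) : ContDiff ℝ (⊤ : ℕ∞) (chr G k i j) :=
  contDiff_const.mul (ContDiff.sum fun l _ => (contDiff_ginv hG hdet k l).mul
    (((contDiff_pd i (hG j l)).add (contDiff_pd j (hG i l))).sub (contDiff_pd l (hG i j))))

lemma sum_mul_ginv {G : Met n} {x : Chart n} (hdet : (G x).det ≠ 0) (i j : Fin n) :
    ∑ k, G x i k * ginv G x k j = if i = j then 1 else 0 := by
  rw [← Matrix.mul_apply, ginv, Matrix.mul_nonsing_inv _ (isUnit_iff_ne_zero.2 hdet),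
    Matrix.one_apply]

lemma sum_ginv_mul {G : Met n} {x : Chart n} (hdet : (G x).det ≠ 0) (i j : Fin n) :
    ∑ k, ginv G x i k * G x k j = if i = j then 1 else 0 := by
  rw [← Matrix.mul_apply, ginv, Matrix.nonsing_inv_mul _ (isUnit_iff_ne_zero.2 hdet),
    Matrix.one_apply]

lemma chr_symm {G : Met n} (hsymm : ∀ x (i j : Fin n), G x i j = G x j i) (k i j : Fin n)
    (x : Chart n) : chr G k i j x = chr G k j i x := by
  simp only [chr, fun y => hsymm y i j]
  congr 1
  exact Finset.sum_congr rfl fun l _ => by ring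

/-- Lowering the upper index of the Christoffel symbols. -/
lemma sum_metric_mul_chr {G : Met n} {x : Chart n} (hdet : (G x).det ≠ 0) (m i j : Fin n) :
    ∑ k, G x m k * chr G k i j x = (1 / 2) * (pd i (fun y => G y j m) x
      + pd j (fun y => G y i m) x - pd m (fun y => G y i j) x) := by
  simp only [chr, Finset.mul_sum]
  rw [Finset.sum_comm]
  calc _ = ∑ l, (∑ k, G x m k * ginv G x k l) * ((1 / 2) * (pd i (fun y => G y j l) x
      + pd j (fun y => G y i l) x - pd l (fun y => G y i j) x)) := by
        refine Finset.sum_congr rfl fun l _ => ?_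
        rw [Finset.sum_mul]
        exact Finset.sum_congr rfl fun k _ => by ring
    _ = _ := by simp [sum_mul_ginv hdet]

lemma pd_metric {G : Met n} (hsymm : ∀ x (i j : Fin n), G x i j = G x j i) {x : Chart n}
    (hdet : (G x).det ≠ 0) (k i j : Fin n) :
    pd k (fun y => G y i j) x
      = (∑ m, G x j m * chr G m k i x) + ∑ m, G x i m * chr G m k j x := by
  rw [sum_metric_mul_chr hdet, sum_metric_mul_chr hdet]
  simp only [fun y => hsymm y j i, fun y => hsymm y k i, fun y => hsymm y k j]
  ring

/-- The difference of the Levi-Civita connections of `e^{2f} g` and `g`, where `a = df` and `A` is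
the gradient of `f`. -/
def conformalDiff (g : Matrix (Fin n) (Fin n) ℝ) (a A : Fin n → ℝ) (k i j : Fin n) : ℝ :=
  (if k = j then a i else 0) + (if k = i then a j else 0) - g i j * A k

lemma sum_mul_conformalDiff (g : Matrix (Fin n) (Fin n) ℝ) (a A u : Fin n → ℝ) (i j : Fin n) :
    ∑ l, u l * conformalDiff g a A l i j = u j * a i + u i * a j - g i j * ∑ l, u l * A l := by
  simp only [conformalDiff, mul_sub, mul_add, Finset.sum_sub_distrib, Finset.sum_add_distrib,
    mul_ite, mul_zero, Finset.sum_ite_eq', Finset.mem_univ, if_true, Finset.mul_sum]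
  congr 1
  exact Finset.sum_congr rfl fun l _ => by ring

lemma sum_conformalDiff (g : Matrix (Fin n) (Fin n) ℝ) (a A : Fin n → ℝ)
    (hA : ∀ i, ∑ k, g k i * A k = a i) (i : Fin n) :
    ∑ k, conformalDiff g a A k k i = n * a i := by
  simp [conformalDiff, Finset.sum_add_distrib, hA]

lemma sum_sum_mul_conformalDiff (g B : Matrix (Fin n) (Fin n) ℝ) (a A : Fin n → ℝ) (i : Fin n) :
    ∑ k, ∑ l, B k l * conformalDiff g a A l k i
      = (∑ k, B k i * a k) + (∑ k, B k k) * a i - ∑ k, ∑ l, g k i * B k l * A l := by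
  simp only [sum_mul_conformalDiff, Finset.sum_sub_distrib, Finset.sum_add_distrib,
    Finset.sum_mul, Finset.mul_sum, mul_assoc]

/-- The Ricci-type quadratic expression in the connection coefficients, under a conformal change. -/
lemma conformal_quadratic (g : Matrix (Fin n) (Fin n) ℝ) (a A : Fin n → ℝ)
    (Γ : Fin n → Fin n → Fin n → ℝ) (hg : ∀ i j, g i j = g j i)
    (hΓ : ∀ k i j, Γ k i j = Γ k j i) (hA : ∀ i, ∑ k, g k i * A k = a i) (i j : Fin n) :
    (∑ k, ∑ l, (Γ k k l + conformalDiff g a A k k l) * (Γ l i j + conformalDiff g a A l i j))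
      - ∑ k, ∑ l, (Γ k j l + conformalDiff g a A k j l) * (Γ l k i + conformalDiff g a A l k i)
    = (∑ k, ∑ l, Γ k k l * Γ l i j) - (∑ k, ∑ l, Γ k j l * Γ l k i)
      + (n - 2) * (∑ k, Γ k i j * a k) - g i j * (∑ l, (∑ k, Γ k k l) * A l)
      + (∑ k, ((∑ m, g j m * Γ m k i) + ∑ m, g i m * Γ m k j) * A k)
      + (n - 2) * a i * a j - (n - 2) * g i j * ∑ l, a l * A l := by
  have h1 : (∑ k, ∑ l, (Γ k k l + conformalDiff g a A k k l)
        * (Γ l i j + conformalDiff g a A l i j))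
      = (∑ k, ∑ l, Γ k k l * Γ l i j) + n * (∑ k, Γ k i j * a k)
        + ((∑ k, Γ k k j) * a i + (∑ k, Γ k k i) * a j - g i j * ∑ l, (∑ k, Γ k k l) * A l)
        + n * (a j * a i + a i * a j - g i j * ∑ l, a l * A l) := by
    rw [Finset.sum_comm, Finset.sum_comm (f := fun k l => Γ k k l * Γ l i j)]
    simp only [← Finset.sum_mul, Finset.sum_add_distrib, sum_conformalDiff g a A hA]
    rw [← sum_mul_conformalDiff g a A a, ← sum_mul_conformalDiff g a A (fun l => ∑ k, Γ k k l)]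
    simp only [Finset.mul_sum, ← Finset.sum_add_distrib]
    exact Finset.sum_congr rfl fun l _ => by ring
  have h2 : (∑ k, ∑ l, Γ k j l * conformalDiff g a A l k i)
      = (∑ k, Γ k i j * a k) + (∑ k, Γ k k j) * a i
        - ∑ k, (∑ m, g i m * Γ m k j) * A k := by
    rw [sum_sum_mul_conformalDiff g (fun k l => Γ k j l)]
    simp only [hΓ _ j, Finset.sum_mul]
    rw [Finset.sum_comm (f := fun k l => g k i * Γ k l j * A l)]
    simp only [hg _ i]
  have h3 : (∑ k, ∑ l, conformalDiff g a A k j l * Γ l k i)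
      = (∑ k, Γ k i j * a k) + (∑ k, Γ k k i) * a j
        - ∑ k, (∑ m, g j m * Γ m k i) * A k := by
    rw [Finset.sum_comm]
    have := sum_sum_mul_conformalDiff g (fun k l => Γ k l i) a A j
    have hc : ∀ k l, conformalDiff g a A l j k = conformalDiff g a A l k j := by
      intro k l
      simp only [conformalDiff, hg j k]
      ring
    simp only [hc, mul_comm (conformalDiff g a A _ _ _)]
    rw [this]
    simp only [hΓ _ j i, Finset.sum_mul]
    rw [Finset.sum_comm (f := fun k l => g k j * Γ k l i * A l)]
    simp only [hg _ j]
  have h4 : (∑ k, ∑ l, conformalDiff g a A k j l * conformalDiff g a A l k i)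
      = (n + 2) * (a i * a j) - 2 * g i j * ∑ l, a l * A l := by
    have hc : ∀ k l, conformalDiff g a A l j k = conformalDiff g a A l k j := by
      intro k l
      simp only [conformalDiff, hg j k]
      ring
    rw [sum_sum_mul_conformalDiff g (fun k l => conformalDiff g a A k j l)]
    have e1 : ∑ k, conformalDiff g a A k j i * a k
        = 2 * a i * a j - g i j * ∑ l, a l * A l := by
      simp only [mul_comm (conformalDiff g a A _ _ _)]
      rw [sum_mul_conformalDiff, hg j i]
      ring
    have e2 : ∑ k, conformalDiff g a A k j k = n * a j := by
      simp only [hc]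
      exact sum_conformalDiff g a A hA j
    have e3 : ∑ k, ∑ l, g k i * conformalDiff g a A k j l * A l
        = g i j * ∑ l, a l * A l := by
      rw [Finset.sum_comm]
      simp only [← Finset.sum_mul]
      simp only [sum_mul_conformalDiff, hA]
      simp only [add_mul, sub_mul, Finset.sum_add_distrib, Finset.sum_sub_distrib]
      have f1 : ∑ l, g l i * a j * A l = a i * a j := by
        rw [← hA i, Finset.sum_mul]
        exact Finset.sum_congr rfl fun l _ => by ring
      have f2 : ∑ l, g j l * a i * A l = a i * a j := by
        rw [← hA j, Finset.mul_sum]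
        exact Finset.sum_congr rfl fun l _ => by rw [hg j l]; ring
      have f3 : ∑ l, g j i * a l * A l = g i j * ∑ l, a l * A l := by
        rw [Finset.mul_sum]
        exact Finset.sum_congr rfl fun l _ => by rw [hg j i]; ring
      rw [f1, f2, f3]
      ring
    rw [e1, e2, e3]
    ring
  have h5 : ∑ k, ∑ l, (Γ k j l + conformalDiff g a A k j l)
        * (Γ l k i + conformalDiff g a A l k i)
      = (∑ k, ∑ l, Γ k j l * Γ l k i) + (∑ k, ∑ l, Γ k j l * conformalDiff g a A l k i)
        + (∑ k, ∑ l, conformalDiff g a A k j l * Γ l k i)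
        + ∑ k, ∑ l, conformalDiff g a A k j l * conformalDiff g a A l k i := by
    simp only [← Finset.sum_add_distrib]
    exact Finset.sum_congr rfl fun k _ => Finset.sum_congr rfl fun l _ => by ring
  rw [h5, h1, h2, h3, h4]
  simp only [add_mul, Finset.sum_add_distrib]
  ring

/-- The components of `df`, where the conformal factor is `φ = e^{2f}`. -/
def halfLogDeriv (φ : Chart n → ℝ) (i : Fin n) (y : Chart n) : ℝ := pd i φ y / (2 * φ y)

lemma chr_conformal {G : Met n} (hG : ∀ i j : Fin n, ContDiff ℝ (⊤ : ℕ∞) fun x => G x i j)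
    (hsymm : ∀ x (i j : Fin n), G x i j = G x j i) {φ : Chart n → ℝ}
    (hφ : ContDiff ℝ (⊤ : ℕ∞) φ) {x : Chart n} (hdet : (G x).det ≠ 0) (hx : φ x ≠ 0)
    (k i j : Fin n) :
    chr (fun y => φ y • G y) k i j x = chr G k i j x + conformalDiff (G x)
      (fun i => halfLogDeriv φ i x) (fun k => ∑ l, ginv G x k l * halfLogDeriv φ l x) k i j := by
  have hinv : ∀ k l, ginv (fun y => φ y • G y) x k l = (φ x)⁻¹ * ginv G x k l := by
    intro k l
    have : (φ x • G x)⁻¹ = (φ x)⁻¹ • (G x)⁻¹ := by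
      refine Matrix.inv_eq_left_inv ?_
      rw [Matrix.smul_mul, Matrix.mul_smul,
        Matrix.nonsing_inv_mul _ (isUnit_iff_ne_zero.2 hdet), smul_smul, inv_mul_cancel₀ hx,
        one_smul]
    simp [ginv, this]
  have hpd : ∀ m p q, pd m (fun y => (φ y • G y) p q) x
      = φ x * pd m (fun y => G y p q) x + pd m φ x * G x p q := fun m p q =>
    pd_mul m (hφ.differentiableAt_of_smooth x) ((hG p q).differentiableAt_of_smooth x)
  have hδ : ∀ p (c : ℝ), (if k = p then c else 0) = ∑ l, ginv G x k l * G x p l * c := by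
    intro p c
    simp only [hsymm x p, ← Finset.sum_mul, sum_ginv_mul hdet, ite_mul, one_mul, zero_mul]
  simp only [chr, conformalDiff, hinv, hpd, hδ, Finset.mul_sum, ← Finset.sum_add_distrib,
    ← Finset.sum_sub_distrib, halfLogDeriv]
  refine Finset.sum_congr rfl fun l _ => ?_
  field_simp
  ring

lemma differentiableAt_halfLogDeriv {φ : Chart n → ℝ} (hφ : ContDiff ℝ (⊤ : ℕ∞) φ)
    {x : Chart n} (hx : φ x ≠ 0) (i : Fin n) : DifferentiableAt ℝ (halfLogDeriv φ i) x := by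
  change DifferentiableAt ℝ (fun y => pd i φ y / (2 * φ y)) x
  simp only [div_eq_mul_inv]
  exact ((contDiff_pd i hφ).differentiableAt_of_smooth x).mul
    (((hφ.differentiableAt_of_smooth x).const_mul 2).fun_inv (by simpa using hx))

lemma pd_halfLogDeriv {φ : Chart n → ℝ} (hφ : ContDiff ℝ (⊤ : ℕ∞) φ) {x : Chart n}
    (hx : φ x ≠ 0) (i j : Fin n) : pd i (halfLogDeriv φ j) x
      = pd i (pd j φ) x / (2 * φ x) - 2 * halfLogDeriv φ i x * halfLogDeriv φ j x := by
  have hd := differentiableAt_halfLogDeriv hφ hx j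
  have he : pd j φ =ᶠ[nhds x] fun y => halfLogDeriv φ j y * (2 * φ y) := by
    filter_upwards [hφ.continuous.continuousAt.eventually_ne hx] with y hy
    simp only [halfLogDeriv]
    field_simp
  have hφd := hφ.differentiableAt_of_smooth x
  have h2 : pd i (fun y => 2 * φ y) x = 2 * pd i φ x := by
    rw [pd_mul i (differentiableAt_const _) hφd]
    simp [pd]
  rw [pd_congr i he, pd_mul i hd (hφd.const_mul 2), h2]
  simp only [halfLogDeriv]
  field_simp
  ring

/-- The divergence of the vector field metrically dual to a one-form. -/
lemma sum_pd_raise {G : Met n} (hG : ∀ i j : Fin n, ContDiff ℝ (⊤ : ℕ∞) fun x => G x i j)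
    (hsymm : ∀ x (i j : Fin n), G x i j = G x j i) (hdet : ∀ x, (G x).det ≠ 0)
    {a : Fin n → Chart n → ℝ} {x : Chart n} (ha : ∀ i, DifferentiableAt ℝ (a i) x) :
    (∑ k, pd k (fun y => ∑ l, ginv G y k l * a l y) x)
        + ∑ l, (∑ k, chr G k k l x) * ∑ m, ginv G x l m * a m x
      = ∑ k, ∑ l, ginv G x k l * (pd k (a l) x - ∑ m, chr G m k l x * a m x) := by
  set A : Fin n → Chart n → ℝ := fun k y => ∑ l, ginv G y k l * a l y with hAdef
  have hAd : ∀ k, DifferentiableAt ℝ (A k) x := fun k => DifferentiableAt.fun_sum fun l _ =>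
    ((contDiff_ginv hG hdet k l).differentiableAt_of_smooth x).mul (ha l)
  have hGA : ∀ l y, a l y = ∑ k, G y l k * A k y := by
    intro l y
    simp only [hAdef, Finset.mul_sum]
    rw [Finset.sum_comm]
    simp only [← mul_assoc, ← Finset.sum_mul, sum_mul_ginv (hdet y)]
    simp
  have hpa : ∀ k l, pd k (a l) x
      = ∑ p, (G x l p * pd k (A p) x + pd k (fun y => G y l p) x * A p x) := by
    intro k l
    rw [show a l = fun y => ∑ p, G y l p * A p y from funext (hGA l), pd_sum]
    · exact Finset.sum_congr rfl fun p _ =>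
        pd_mul k ((hG l p).differentiableAt_of_smooth x) (hAd p)
    · exact fun p => ((hG l p).differentiableAt_of_smooth x).mul (hAd p)
  have hpa' : ∀ k l, pd k (a l) x - ∑ m, chr G m k l x * a m x
      = ∑ p, G x l p * (pd k (A p) x + ∑ q, chr G p k q x * A q x) := by
    intro k l
    have e1 : ∑ m, chr G m k l x * a m x = ∑ p, (∑ m, G x p m * chr G m k l x) * A p x := by
      simp only [hGA, Finset.mul_sum, Finset.sum_mul]
      rw [Finset.sum_comm]
      exact Finset.sum_congr rfl fun p _ => Finset.sum_congr rfl fun m _ => by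
        rw [hsymm x p m]; ring
    have e2 : ∑ p, G x l p * ∑ q, chr G p k q x * A q x
        = ∑ p, (∑ m, G x l m * chr G m k p x) * A p x := by
      simp only [Finset.mul_sum, Finset.sum_mul]
      rw [Finset.sum_comm]
      exact Finset.sum_congr rfl fun p _ => Finset.sum_congr rfl fun m _ => by ring
    simp only [mul_add, Finset.sum_add_distrib]
    rw [hpa, e1, e2]
    simp only [pd_metric hsymm (hdet x), add_mul, Finset.sum_add_distrib]
    ring
  have hcontr : ∀ k, ∑ l, ginv G x k l * (pd k (a l) x - ∑ m, chr G m k l x * a m x)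
      = pd k (A k) x + ∑ q, chr G k k q x * A q x := by
    intro k
    simp only [hpa', Finset.mul_sum]
    rw [Finset.sum_comm]
    simp only [← mul_assoc, ← Finset.sum_mul, sum_ginv_mul (hdet x)]
    simp
  simp only [hcontr, Finset.sum_add_distrib, Finset.sum_mul]
  rw [Finset.sum_comm (f := fun l k => chr G k k l x * A l x)]

/-- The Ricci tensor of the conformal metric `φ g`. -/
theorem ricci_conformal {G : Met n}
    (hG : ∀ i j : Fin n, ContDiff ℝ (⊤ : ℕ∞) fun x => G x i j)
    (hsymm : ∀ x (i j : Fin n), G x i j = G x j i) (hdet : ∀ x, (G x).det ≠ 0)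
    {φ : Chart n → ℝ} (hφ : ContDiff ℝ (⊤ : ℕ∞) φ) {x : Chart n} (hx : φ x ≠ 0) (i j : Fin n) :
    ricci (fun y => φ y • G y) i j x = ricci G i j x
      - (n - 2) * (pd i (halfLogDeriv φ j) x - ∑ k, chr G k i j x * halfLogDeriv φ k x)
      - G x i j * (∑ k, ∑ l, ginv G x k l *
          (pd k (halfLogDeriv φ l) x - ∑ m, chr G m k l x * halfLogDeriv φ m x))
      + (n - 2) * halfLogDeriv φ i x * halfLogDeriv φ j x
      - (n - 2) * G x i j *
          ∑ k, ∑ l, ginv G x k l * halfLogDeriv φ k x * halfLogDeriv φ l x := by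
  set a := halfLogDeriv φ with ha
  set A : Fin n → Chart n → ℝ := fun k y => ∑ l, ginv G y k l * a l y with hAdef
  have had : ∀ i, DifferentiableAt ℝ (a i) x := differentiableAt_halfLogDeriv hφ hx
  have hAd : ∀ k, DifferentiableAt ℝ (A k) x := fun k => DifferentiableAt.fun_sum fun l _ =>
    ((contDiff_ginv hG hdet k l).differentiableAt_of_smooth x).mul (had l)
  have hGd : ∀ p q, DifferentiableAt ℝ (fun y => G y p q) x := fun p q =>
    (hG p q).differentiableAt_of_smooth x
  have hΓd : ∀ k p q, DifferentiableAt ℝ (fun y => chr G k p q y) x := fun k p q =>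
    (contDiff_chr hG hdet k p q).differentiableAt_of_smooth x
  have hchr : ∀ k p q, (fun y => chr (fun y => φ y • G y) k p q y) =ᶠ[nhds x] fun y =>
      chr G k p q y + conformalDiff (G y) (fun i => a i y) (fun k => A k y) k p q := by
    intro k p q
    filter_upwards [hφ.continuous.continuousAt.eventually_ne hx] with y hy
    exact chr_conformal hG hsymm hφ (hdet y) hy k p q
  have hCd : ∀ k p q, DifferentiableAt ℝ
      (fun y => conformalDiff (G y) (fun i => a i y) (fun k => A k y) k p q) x := by
    intro k p q
    refine ((DifferentiableAt.add ?_ ?_).sub ((hGd p q).mul (hAd k)))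
    · split_ifs
      exacts [had p, differentiableAt_const _]
    · split_ifs
      exacts [had q, differentiableAt_const _]
  have hGA : ∀ l y, ∑ k, G y k l * A k y = a l y := by
    intro l y
    simp only [hAdef, Finset.mul_sum, hsymm y _ l]
    rw [Finset.sum_comm]
    simp only [← mul_assoc, ← Finset.sum_mul, sum_mul_ginv (hdet y)]
    simp
  have hpda : pd j (a i) x = pd i (a j) x := by
    rw [ha, pd_halfLogDeriv hφ hx, pd_halfLogDeriv hφ hx, pd_comm i j hφ]
    ring
  have hpdite : ∀ (k p q r : Fin n), pd k (fun y => if p = q then a r y else 0) x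
      = if p = q then pd k (a r) x else 0 := by
    intro k p q r
    split_ifs
    · rfl
    · simp [pd]
  have hite : ∀ (p q r : Fin n), DifferentiableAt ℝ (fun y => if p = q then a r y else 0) x := by
    intro p q r
    split_ifs
    exacts [had r, differentiableAt_const _]
  have t1 : ∑ k, pd k (fun y => chr (fun y => φ y • G y) k i j y) x
      = (∑ k, pd k (fun y => chr G k i j y) x) + 2 * pd i (a j) x
        - G x i j * (∑ k, pd k (A k) x) - ∑ k, pd k (fun y => G y i j) x * A k x := by
    have : ∀ k, pd k (fun y => chr (fun y => φ y • G y) k i j y) x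
        = pd k (fun y => chr G k i j y) x + ((if k = j then pd k (a i) x else 0)
          + (if k = i then pd k (a j) x else 0)
          - (G x i j * pd k (A k) x + pd k (fun y => G y i j) x * A k x)) := by
      intro k
      rw [pd_congr k (hchr k i j), pd_add k (hΓd k i j) (hCd k i j), ← hpdite, ← hpdite,
        ← pd_add k (hite _ _ _) (hite _ _ _), ← pd_mul k (hGd i j) (hAd k)]
      exact congrArg _ (pd_sub k ((hite _ _ _).add (hite _ _ _)) ((hGd i j).mul (hAd k)))
    simp only [this, Finset.sum_add_distrib, Finset.sum_sub_distrib, Finset.sum_ite_eq',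
      Finset.mem_univ, if_true, hpda, Finset.mul_sum]
    ring
  have t2 : ∑ k, pd j (fun y => chr (fun y => φ y • G y) k k i y) x
      = (∑ k, pd j (fun y => chr G k k i y) x) + n * pd i (a j) x := by
    have : ∀ k, pd j (fun y => chr (fun y => φ y • G y) k k i y) x
        = pd j (fun y => chr G k k i y) x + pd j (fun y =>
          conformalDiff (G y) (fun i => a i y) (fun k => A k y) k k i) x := by
      intro k
      rw [pd_congr j (hchr k k i), pd_add j (hΓd k k i) (hCd k k i)]
    simp only [this, Finset.sum_add_distrib]
    rw [← pd_sum Finset.univ j fun k => hCd k k i]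
    simp only [fun y => sum_conformalDiff (G y) (fun i => a i y) (fun k => A k y)
      (fun l => hGA l y) i]
    rw [pd_mul j (differentiableAt_const _) (had i), ← hpda]
    simp [pd]
  have hdiv := sum_pd_raise hG hsymm hdet had
  have hquad := conformal_quadratic (G x) (fun i => a i x) (fun k => A k x)
    (fun k p q => chr G k p q x) (hsymm x) (fun k p q => chr_symm hsymm k p q x)
    (fun l => hGA l x) i j
  have hnorm : ∑ l, a l x * A l x = ∑ k, ∑ l, ginv G x k l * a k x * a l x := by
    simp only [hAdef, Finset.mul_sum]
    exact Finset.sum_congr rfl fun k _ => Finset.sum_congr rfl fun l _ => by ring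
  simp only [← pd_metric hsymm (hdet x)] at hquad
  rw [← hdiv, ← hnorm]
  have hchrx : ∀ k p q, chr (fun y => φ y • G y) k p q x
      = chr G k p q x + conformalDiff (G x) (fun i => a i x) (fun k => A k x) k p q :=
    fun k p q => chr_conformal hG hsymm hφ (hdet x) hx k p q
  unfold ricci
  rw [t1, t2]
  simp only [hchrx]
  linear_combination hquad

/-- The Ricci tensor along the conformal ray `(1 + t v) g`. -/
theorem ricci_conformal_ray {G : Met n}
    (hG : ∀ i j : Fin n, ContDiff ℝ (⊤ : ℕ∞) fun x => G x i j)
    (hsymm : ∀ x (i j : Fin n), G x i j = G x j i) (hdet : ∀ x, (G x).det ≠ 0)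
    {v : Chart n → ℝ} (hv : ContDiff ℝ (⊤ : ℕ∞) v) {x : Chart n} {t : ℝ}
    (hx : 1 + t * v x ≠ 0) (i j : Fin n) :
    ricci (fun y => (1 + t * v y) • G y) i j x = ricci G i j x
      + (1 / 2 * (lapC G v x * G x i j - (n - 2) * hessC G v i j x)) * (t / (1 + t * v x))
      + (3 / 4 * (n - 2) * (pd i v x * pd j v x) - (n - 4) / 4 * (gradsq G v x * G x i j))
        * (t / (1 + t * v x)) ^ 2 := by
  have hφ : ContDiff ℝ (⊤ : ℕ∞) fun y => 1 + t * v y :=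
    contDiff_const.add (contDiff_const.mul hv)
  have hpd : ∀ k, pd k (fun y => 1 + t * v y) = fun y => t * pd k v y := by
    intro k
    funext y
    have hd := hv.differentiableAt_of_smooth y
    rw [pd_add k (differentiableAt_const _) (hd.const_mul t),
      pd_mul k (differentiableAt_const _) hd]
    simp [pd]
  have hpd2 : ∀ k l, pd k (pd l fun y => 1 + t * v y) x = t * pd k (pd l v) x := by
    intro k l
    rw [hpd, pd_mul k (differentiableAt_const _)
      ((contDiff_pd l hv).differentiableAt_of_smooth x)]
    simp [pd]
  have ha : ∀ k, halfLogDeriv (fun y => 1 + t * v y) k x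
      = 1 / 2 * (t / (1 + t * v x)) * pd k v x := by
    intro k
    simp only [halfLogDeriv, hpd]
    field_simp
  set s := t / (1 + t * v x) with hs
  have hess : ∀ k l, pd k (halfLogDeriv (fun y => 1 + t * v y) l) x
        - ∑ m, chr G m k l x * halfLogDeriv (fun y => 1 + t * v y) m x
      = 1 / 2 * s * hessC G v k l x - 1 / 2 * s ^ 2 * (pd k v x * pd l v x) := by
    intro k l
    have e : ∑ m, chr G m k l x * (1 / 2 * s * pd m v x)
        = 1 / 2 * s * ∑ m, chr G m k l x * pd m v x := by
      rw [Finset.mul_sum]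
      exact Finset.sum_congr rfl fun m _ => by ring
    have e' : t * pd k (pd l v) x / (2 * (1 + t * v x)) = 1 / 2 * s * pd k (pd l v) x := by
      rw [hs]
      field_simp
    simp only [pd_halfLogDeriv hφ hx, hpd2, ha, e, e', hessC]
    ring
  have htr : ∑ k, ∑ l, ginv G x k l *
        (1 / 2 * s * hessC G v k l x - 1 / 2 * s ^ 2 * (pd k v x * pd l v x))
      = - (1 / 2 * s * lapC G v x) - 1 / 2 * s ^ 2 * gradsq G v x := by
    simp only [lapC, gradsq, mul_neg, neg_neg, Finset.mul_sum, ← Finset.sum_sub_distrib]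
    exact Finset.sum_congr rfl fun k _ => Finset.sum_congr rfl fun l _ => by ring
  have hsq : ∑ k, ∑ l, ginv G x k l * (1 / 2 * s * pd k v x) * (1 / 2 * s * pd l v x)
      = 1 / 4 * s ^ 2 * gradsq G v x := by
    simp only [gradsq, Finset.mul_sum]
    exact Finset.sum_congr rfl fun k _ => Finset.sum_congr rfl fun l _ => by ring
  rw [ricci_conformal hG hsymm hdet hφ hx]
  simp only [hess, htr]
  simp only [ha, hsq]
  ring

end Coordinates

lemma iteratedDeriv_two_conformal_ray (c b d w : ℝ) :
    iteratedDeriv 2 (fun t : ℝ => c + b * (t / (1 + t * w)) + d * (t / (1 + t * w)) ^ 2) 0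
      = 2 * d - 2 * b * w := by
  have hne : ∀ᶠ t : ℝ in nhds 0, 1 + t * w ≠ 0 :=
    ContinuousAt.eventually_ne (by fun_prop) (by simp)
  have hlin : ∀ t : ℝ, HasDerivAt (fun t : ℝ => 1 + t * w) w t := fun t => by
    simpa using ((hasDerivAt_id t).mul_const w).const_add 1
  have hs : ∀ t : ℝ, 1 + t * w ≠ 0 →
      HasDerivAt (fun t : ℝ => t / (1 + t * w)) (1 / (1 + t * w) ^ 2) t := fun t ht => by
    have h := (hasDerivAt_id' t).fun_div (hlin t) ht
    rwa [show 1 * (1 + t * w) - t * w = 1 by ring] at h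
  have hd1 : deriv (fun t : ℝ => c + b * (t / (1 + t * w)) + d * (t / (1 + t * w)) ^ 2)
      =ᶠ[nhds 0] fun t => (b + 2 * d * (t / (1 + t * w))) * (1 / (1 + t * w) ^ 2) := by
    filter_upwards [hne] with t ht
    rw [((((hs t ht).const_mul b).const_add c).fun_add (((hs t ht).fun_pow 2).const_mul d)).deriv]
    push_cast
    ring
  rw [iteratedDeriv_succ, iteratedDeriv_one, hd1.deriv_eq]
  have h0 : (1 : ℝ) + 0 * w ≠ 0 := by simp
  have hq : HasDerivAt (fun t : ℝ => 1 / (1 + t * w) ^ 2) (-(2 * w)) 0 := by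
    have := ((hlin 0).fun_pow 2).fun_inv (by simp)
    simpa using this
  have := (((hs 0 h0).const_mul (2 * d)).const_add b).fun_mul hq
  rw [HasDerivAt.deriv this]
  simp
  ring

/-- **Second variation of the Ricci tensor along a conformal eigen-direction.**
Let `(M,g_E)` be a closed positive Einstein manifold with Einstein constant `μ`
(given in a coordinate chart, so `Ric = μ g_E`) and `v` smooth with `Δv = 2μv`.
The second variation of the Ricci tensor along `g_t = (1+tv) g_E` is
`d²/dt²|_{t=0} Ric_{g_t} = −(n/2 − 2)|∇v|² g_E − 2μ v² g_E + 3(n/2 − 1) ∇v⊗∇v + (n−2) v ∇²v`. -/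
theorem secondVariation_ricci_conformal
    (n : ℕ) (hn : 1 ≤ n) (μ : ℝ) (hμ : 0 < μ)
    (G : Met n) (v : Chart n → ℝ)
    (hGpos : ∀ x, (G x).PosDef)
    (hGsmooth : ∀ i j : Fin n, ContDiff ℝ (⊤ : ℕ∞) fun x => G x i j)
    (hv : ContDiff ℝ (⊤ : ℕ∞) v)
    (hEinstein : ∀ (x : Chart n) (i j : Fin n), ricci G i j x = μ * G x i j)
    (heig : ∀ x, lapC G v x = 2 * μ * v x)
    (x : Chart n) (i j : Fin n) :
    iteratedDeriv 2 (fun t : ℝ => ricci (fun y => (1 + t * v y) • G y) i j x) 0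
      = -((n : ℝ)/2 - 2) * gradsq G v x * G x i j
        - 2 * μ * (v x) ^ 2 * G x i j
        + 3 * ((n : ℝ)/2 - 1) * pd i v x * pd j v x
        + ((n : ℝ) - 2) * v x * hessC G v i j x := by
  have hsymm : ∀ x (i j : Fin n), G x i j = G x j i := fun x i j => by
    simpa using (hGpos x).isHermitian.apply j i
  have hdet : ∀ x, (G x).det ≠ 0 := fun x => (hGpos x).det_pos.ne'
  have hray : (fun t : ℝ => ricci (fun y => (1 + t * v y) • G y) i j x) =ᶠ[nhds 0] fun t =>
      ricci G i j x + (1 / 2 * (lapC G v x * G x i j - (n - 2) * hessC G v i j x))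
          * (t / (1 + t * v x))
        + (3 / 4 * (n - 2) * (pd i v x * pd j v x) - (n - 4) / 4 * (gradsq G v x * G x i j))
          * (t / (1 + t * v x)) ^ 2 := by
    have hne : ∀ᶠ t : ℝ in nhds 0, 1 + t * v x ≠ 0 :=
      ContinuousAt.eventually_ne (by fun_prop) (by simp)
    filter_upwards [hne] with t ht
    exact ricci_conformal_ray hGsmooth hsymm hdet hv ht i j
  rw [hray.iteratedDeriv_eq, iteratedDeriv_two_conformal_ray, heig]
  ring
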